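/- Let k, m, n be positive integers, let p_1, …, p_m ∈ [0,1] with p = max_j p_j > 0, and suppose n·∑_{j=1}^m p_j² = c with c > 1. Let I_1, …, I_m be independent Bernoulli random variables where I_j equals 1 with probability 1 − (1 − p_j)^k, and set S = ∑_{j=1}^m p_j·I_j. Then P[ S ≥ (2c−1)·k/n ] ≤ exp( −3·(c−1)²·k / (2·n·p·(4c−1)) ). -/

import Mathlib

open MeasureTheory

/-- The Bernoulli measure on `Bool` with success probability `p`. -/
noncomputable def bernoulliBool (p : ℝ) : Measure Bool :=
  ENNReal.ofReal p • Measure.dirac true + ENNReal.ofReal (1 - p) • Measure.dirac false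

instance (p : ℝ) : IsFiniteMeasure (bernoulliBool p) := by
  constructor
  simp only [bernoulliBool, Measure.coe_add, Measure.smul_apply, Pi.add_apply,
    smul_eq_mul, measure_univ, mul_one]
  exact ENNReal.add_lt_top.mpr ⟨ENNReal.ofReal_lt_top, ENNReal.ofReal_lt_top⟩

/-- Maximum of the attribute probabilities. -/
noncomputable def pmax {m : ℕ} (p : Fin m → ℝ) : ℝ := ⨆ j, p j

theorem integral_bernoulliBool {q : ℝ} (hq0 : 0 ≤ q) (hq1 : q ≤ 1) (f : Bool → ℝ) :
    ∫ b, f b ∂bernoulliBool q = q * f true + (1 - q) * f false := by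
  rw [bernoulliBool, integral_add_measure (Integrable.of_finite.smul_measure ENNReal.ofReal_ne_top)
    (Integrable.of_finite.smul_measure ENNReal.ofReal_ne_top),
    integral_smul_measure, integral_smul_measure, integral_dirac, integral_dirac,
    ENNReal.toReal_ofReal hq0, ENNReal.toReal_ofReal (sub_nonneg.mpr hq1), smul_eq_mul, smul_eq_mul]

theorem exp_sub_one_le_of_le_one {x : ℝ} (hx0 : 0 ≤ x) (hx1 : x ≤ 1) :
    Real.exp x - 1 ≤ x + x ^ 2 / (2 * (1 - x / 3)) := by
  have h := Real.exp_bound' hx0 hx1 (n := 4) (by norm_num)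
  simp only [Finset.sum_range_succ, Finset.sum_range_zero, Nat.factorial] at h
  norm_num at h
  have hd : 0 < 2 * (1 - x / 3) := by linarith
  have h2 : x ^ 2 / 2 + x ^ 3 / 6 + x ^ 4 / 18 ≤ x ^ 2 / (2 * (1 - x / 3)) := by
    rw [le_div_iff₀ hd]
    have : 0 ≤ x ^ 5 := by positivity
    nlinarith
  have : 0 ≤ x ^ 4 := by positivity
  linarith

/-- The chord of `exp` over `[0, x]` lies above its graph. -/
theorem exp_mul_sub_one_le {s : ℝ} (x : ℝ) (hs0 : 0 ≤ s) (hs1 : s ≤ 1) :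
    Real.exp (s * x) - 1 ≤ s * (Real.exp x - 1) := by
  have h := convexOn_exp.2 (Set.mem_univ x) (Set.mem_univ 0) hs0 (sub_nonneg.mpr hs1) (by ring)
  simp only [smul_eq_mul, mul_zero, add_zero, Real.exp_zero, mul_one] at h
  linarith

theorem one_sub_one_sub_pow_le {a : ℝ} (ha : a ≤ 1) (k : ℕ) : 1 - (1 - a) ^ k ≤ k * a := by
  have h := one_add_mul_le_pow (a := -a) (by linarith) k
  rw [← sub_eq_add_neg] at h
  linarith

theorem integral_exp_bernoulliBool_le {a P x : ℝ} (k : ℕ) (ha0 : 0 ≤ a) (ha1 : a ≤ 1)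
    (haP : a ≤ P) (hP : 0 < P) (hx : 0 ≤ x) :
    ∫ b, Real.exp (x / P * (a * (if b = true then 1 else 0))) ∂bernoulliBool (1 - (1 - a) ^ k) ≤
      Real.exp (k * a ^ 2 * ((Real.exp x - 1) / P)) := by
  have hpow0 : 0 ≤ (1 - a) ^ k := pow_nonneg (by linarith) k
  have hpow1 : (1 - a) ^ k ≤ 1 := pow_le_one₀ (by linarith) (by linarith)
  rw [integral_bernoulliBool (by linarith) (by linarith)]
  simp only [if_true, Bool.false_eq_true, if_false, mul_one, mul_zero, Real.exp_zero]
  have hchord := exp_mul_sub_one_le x (div_nonneg ha0 hP.le) ((div_le_one hP).mpr haP)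
  rw [show a / P * x = x / P * a by ring] at hchord
  have hE : 0 ≤ Real.exp x - 1 := by linarith [Real.add_one_le_exp x]
  calc
    _ = (1 - (1 - a) ^ k) * (Real.exp (x / P * a) - 1) + 1 := by ring
    _ ≤ k * a * (a / P * (Real.exp x - 1)) + 1 := by
      gcongr ?_ + 1
      refine (mul_le_mul_of_nonneg_left hchord (by linarith)).trans ?_
      exact mul_le_mul_of_nonneg_right (one_sub_one_sub_pow_le ha1 k) (by positivity)
    _ = k * a ^ 2 * ((Real.exp x - 1) / P) + 1 := by ring
    _ ≤ _ := Real.add_one_le_exp _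

theorem mul_exp_sub_one_sub_le {c : ℝ} (hc : 1 < c) :
    c * (Real.exp (3 * (c - 1) / (4 * c - 1)) - 1) - 3 * (c - 1) / (4 * c - 1) * (2 * c - 1) ≤
      -(3 * (c - 1) ^ 2 / (2 * (4 * c - 1))) := by
  have hd : 0 < 4 * c - 1 := by linarith
  have h := exp_sub_one_le_of_le_one (x := 3 * (c - 1) / (4 * c - 1))
    (div_nonneg (by linarith) hd.le) ((div_le_one hd).mpr (by linarith))
  have h1 : 1 - 3 * (c - 1) / (4 * c - 1) / 3 = 3 * c / (4 * c - 1) := by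
    rw [eq_div_iff hd.ne', sub_mul, div_right_comm, div_mul_cancel₀ _ hd.ne']
    ring
  rw [h1] at h
  refine (sub_le_sub_right (mul_le_mul_of_nonneg_left h (by linarith)) _).trans (le_of_eq ?_)
  have hc0 : c ≠ 0 := by linarith
  field_simp
  ring

/-- upper tail for the discovered weight: let `I_j` be independent
Bernoulli indicators with success probabilities `1 - (1 - p_j)^k`, and
`S = ∑ p_j·I_j`. If `n·∑ p_j² = c > 1` and `p = max p_j > 0`, then
`P[S ≥ (2c-1)·k/n] ≤ exp(-3·(c-1)²·k/(2·n·p·(4c-1)))`. -/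
theorem discovered_weight_upper_tail (k m n : ℕ) (hk : 0 < k) (hm : 0 < m) (hn : 0 < n)
    (p : Fin m → ℝ) (hp0 : ∀ j, 0 ≤ p j) (hp1 : ∀ j, p j ≤ 1)
    (hpmax : 0 < pmax p)
    (c : ℝ) (hc : 1 < c)
    (hc' : (n : ℝ) * ∑ j, p j ^ 2 = c) :
    (Measure.pi fun j : Fin m => bernoulliBool (1 - (1 - p j) ^ k))
      {ω | (2 * c - 1) * k / n ≤
        ∑ j : Fin m, p j * (if ω j = true then 1 else 0)} ≤
      ENNReal.ofReal
        (Real.exp (-(3 * (c - 1) ^ 2 * k) / (2 * n * pmax p * (4 * c - 1)))) := by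
  have hle (j : Fin m) : p j ≤ pmax p := le_ciSup (Set.finite_range p).bddAbove j
  have hn' : (0 : ℝ) < n := by exact_mod_cast hn
  set x : ℝ := 3 * (c - 1) / (4 * c - 1) with hx
  have hx0 : 0 ≤ x := div_nonneg (by linarith) (by linarith)
  set μ := Measure.pi fun j : Fin m => bernoulliBool (1 - (1 - p j) ^ k)
  set S : (Fin m → Bool) → ℝ := fun ω => ∑ j, p j * (if ω j = true then 1 else 0) with hS
  have hmgf : ProbabilityTheory.mgf S μ (x / pmax p) ≤
      Real.exp (k * (c / n) * ((Real.exp x - 1) / pmax p)) := by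
    simp only [ProbabilityTheory.mgf, hS, Finset.mul_sum, Real.exp_sum]
    rw [integral_fintype_prod_eq_prod (fun j b =>
      Real.exp (x / pmax p * (p j * (if b = true then 1 else 0)))),
      eq_div_of_mul_eq hn'.ne' ((mul_comm _ _).trans hc') |>.symm, Finset.mul_sum,
      Finset.sum_mul, Real.exp_sum]
    exact Finset.prod_le_prod (fun j _ => integral_nonneg fun b => (Real.exp_pos _).le)
      fun j _ => integral_exp_bernoulliBool_le k (hp0 j) (hp1 j) (hle j) hpmax hx0
  have hchernoff := ProbabilityTheory.measure_ge_le_exp_mul_mgf (μ := μ) (X := S)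
    ((2 * c - 1) * k / n) (div_nonneg hx0 hpmax.le) Integrable.of_finite
  rw [ENNReal.le_ofReal_iff_toReal_le (measure_ne_top _ _) (Real.exp_pos _).le]
  refine hchernoff.trans
    ((mul_le_mul_of_nonneg_left hmgf (Real.exp_pos _).le).trans ?_)
  rw [← Real.exp_add, Real.exp_le_exp]
  calc
    _ = k / (n * pmax p) * (c * (Real.exp x - 1) - x * (2 * c - 1)) := by
      field_simp
      ring
    _ ≤ k / (n * pmax p) * -(3 * (c - 1) ^ 2 / (2 * (4 * c - 1))) :=
      mul_le_mul_of_nonneg_left (mul_exp_sub_one_sub_le hc) (by positivity)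
    _ = _ := by
      have hd : 4 * c - 1 ≠ 0 := by linarith
      field_simp
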